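/- Let s_1, s_2, s'_1, s'_2, t_0, t_1, t_2 be simple braids satisfying t_0 s_1 = s'_1 t_1 and t_1 s_2 = s'_2 t_2. If (s_1, s_2) and (s'_1, t_1) are normal pairs, then (s'_1, s'_2) is a normal pair. -/

import Mathlib

/-- Relations of the braid group presentation. -/
def braidRels (n : ℕ) : Set (FreeGroup (Fin (n - 1))) :=
  {r | (∃ i j : Fin (n - 1), (i : ℕ) + 2 ≤ (j : ℕ) ∧
          r = FreeGroup.of i * FreeGroup.of j * (FreeGroup.of j * FreeGroup.of i)⁻¹) ∨
       (∃ i j : Fin (n - 1), (i : ℕ) + 1 = (j : ℕ) ∧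
          r = FreeGroup.of i * FreeGroup.of j * FreeGroup.of i *
              (FreeGroup.of j * FreeGroup.of i * FreeGroup.of j)⁻¹)}

/-- Artin's braid group `B_n`. -/
def BraidGroup (n : ℕ) : Type := PresentedGroup (braidRels n)

instance (n : ℕ) : Group (BraidGroup n) :=
  inferInstanceAs (Group (PresentedGroup (braidRels n)))

/-- The Artin generator `σ_{i+1}` (0-indexed `i`). -/
def braidGen {n : ℕ} (i : Fin (n - 1)) : BraidGroup n := PresentedGroup.of i

/-- The positive braid monoid `B_n^+` (submonoid generated by the `σ_i`). -/
def PosBraid (n : ℕ) : Submonoid (BraidGroup n) :=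
  Submonoid.closure (Set.range (braidGen (n := n)))

/-- `x` left-divides `y` (with positive quotient). -/
def DividesL {n : ℕ} (x y : BraidGroup n) : Prop := ∃ z ∈ PosBraid n, y = x * z

/-- `x` right-divides `y` (with positive quotient). -/
def DividesR {n : ℕ} (x y : BraidGroup n) : Prop := ∃ z ∈ PosBraid n, y = z * x

/-- Auxiliary: `deltaAux n m` is the Garside element `Δ_m` viewed inside `B_n`. -/
def deltaAux (n : ℕ) : ℕ → BraidGroup n
  | 0 => 1
  | m + 1 =>
      ((List.range m).map (fun i =>
        if h : i < n - 1 then braidGen ⟨i, h⟩ else 1)).prod * deltaAux n m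

/-- Garside's element `Δ_n = σ_1⋯σ_{n-1} Δ_{n-1}`. -/
def braidDelta (n : ℕ) : BraidGroup n := deltaAux n n

/-- A simple braid: a (positive) divisor of `Δ_n`. -/
def Simple {n : ℕ} (s : BraidGroup n) : Prop :=
  s ∈ PosBraid n ∧ DividesL s (braidDelta n)

/-- Normality of a pair, in the divisor form: every `σ_i` left-dividing `t`
right-divides `s`. -/
def NormalPair {n : ℕ} (s t : BraidGroup n) : Prop :=
  ∀ i : Fin (n - 1), DividesL (braidGen i) t → DividesR (braidGen i) s

/-- `g` is the left gcd of `x` and `y` in `B_n^+`. -/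
def IsLeftGcd {n : ℕ} (g x y : BraidGroup n) : Prop :=
  g ∈ PosBraid n ∧ DividesL g x ∧ DividesL g y ∧
    ∀ d ∈ PosBraid n, DividesL d x → DividesL d y → DividesL d g

/-- Normality of a pair, in the gcd form: `s = gcd_L(st, Δ_n)`. -/
def GNormal {n : ℕ} (s t : BraidGroup n) : Prop :=
  IsLeftGcd s (s * t) (braidDelta n)

/-- `u` is the left lcm of `x` and `y`. -/
def IsLeftLcm {n : ℕ} (u x y : BraidGroup n) : Prop :=
  DividesR x u ∧ DividesR y u ∧ ∀ v, DividesR x v → DividesR y v → DividesR u v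

/-- The position `i` inside `Fin n`. -/
def finL {n : ℕ} (i : Fin (n - 1)) : Fin n := ⟨i, by have := i.isLt; omega⟩

/-- The position `i + 1` inside `Fin n`. -/
def finR {n : ℕ} (i : Fin (n - 1)) : Fin n := ⟨(i : ℕ) + 1, by have := i.isLt; omega⟩

/-- `i` is a descent of the permutation `f` : `f(i) > f(i+1)`. -/
def Descent {n : ℕ} (f : Equiv.Perm (Fin n)) (i : Fin (n - 1)) : Prop :=
  f (finR i) < f (finL i)

/-- `i` is a recoil of the permutation `f` : `f⁻¹(i) > f⁻¹(i+1)`. -/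
def Recoil {n : ℕ} (f : Equiv.Perm (Fin n)) (i : Fin (n - 1)) : Prop :=
  f⁻¹ (finR i) < f⁻¹ (finL i)

/-- Braid words: letters are a generator index together with a sign
(`true` = positive letter `σ_i`, `false` = negative letter `σ_i⁻¹`). -/
abbrev BWord (n : ℕ) := List (Fin (n - 1) × Bool)

/-- The braid represented by a braid word. -/
def evalWord {n : ℕ} (w : BWord n) : BraidGroup n :=
  (w.map (fun x => if x.2 then braidGen x.1 else (braidGen x.1)⁻¹)).prod

namespace BraidAux

/-- Adjacency of generator indices. -/
def Adj {k : ℕ} (i j : Fin k) : Prop := (i : ℕ) + 1 = j ∨ (j : ℕ) + 1 = i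

/-- Artin relations between words. -/
inductive ARel (k : ℕ) : FreeMonoid (Fin k) → FreeMonoid (Fin k) → Prop
  | comm (i j : Fin k) (h : i ≠ j) (h' : ¬ Adj i j) :
      ARel k (FreeMonoid.of i * FreeMonoid.of j) (FreeMonoid.of j * FreeMonoid.of i)
  | braid (i j : Fin k) (h : Adj i j) :
      ARel k (FreeMonoid.of i * (FreeMonoid.of j * FreeMonoid.of i))
        (FreeMonoid.of j * (FreeMonoid.of i * FreeMonoid.of j))

/-- The abstract braid monoid. -/
abbrev BM (k : ℕ) := PresentedMonoid (ARel k)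

/-- Generators of the braid monoid. -/
def sg {k : ℕ} (i : Fin k) : BM k := PresentedMonoid.of (ARel k) i

theorem Adj.symm {k : ℕ} {i j : Fin k} (h : Adj i j) : Adj j i := Or.symm h

theorem Adj.ne {k : ℕ} {i j : Fin k} (h : Adj i j) : i ≠ j := by
  rintro rfl; unfold Adj at h; omega

theorem sg_comm {k : ℕ} {i j : Fin k} (h : i ≠ j) (h' : ¬ Adj i j) :
    sg i * sg j = sg j * sg i :=
  PresentedMonoid.mk_eq_mk_of_rel (ARel.comm i j h h')

theorem sg_braid {k : ℕ} {i j : Fin k} (h : Adj i j) :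
    sg i * (sg j * sg i) = sg j * (sg i * sg j) :=
  PresentedMonoid.mk_eq_mk_of_rel (ARel.braid i j h)

theorem sg_comm' {k : ℕ} {i j : Fin k} (h : i ≠ j) (h' : ¬ Adj i j) (x : BM k) :
    sg i * (sg j * x) = sg j * (sg i * x) := by
  rw [← mul_assoc, sg_comm h h', mul_assoc]

theorem sg_braid' {k : ℕ} {i j : Fin k} (h : Adj i j) (x : BM k) :
    sg i * (sg j * (sg i * x)) = sg j * (sg i * (sg j * x)) := by
  have := congrArg (· * x) (sg_braid h)
  simpa only [mul_assoc] using this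

/-- Length. -/
def lenHom (k : ℕ) : BM k →* Multiplicative ℕ :=
  PresentedMonoid.lift (fun _ => Multiplicative.ofAdd 1) (by
    intro a b h
    cases h <;> simp)

/-- Length as a natural number. -/
def len {k : ℕ} (x : BM k) : ℕ := Multiplicative.toAdd (lenHom k x)

theorem len_mul {k : ℕ} (x y : BM k) : len (x * y) = len x + len y := by simp [len]

theorem len_sg {k : ℕ} (i : Fin k) : len (sg i) = 1 := rfl

/-- The lcm property for two factorizations. -/
def L {k : ℕ} (i j : Fin k) (u v : BM k) : Prop :=
  (i = j ∧ u = v) ∨ (i ≠ j ∧ ¬ Adj i j ∧ ∃ w, u = sg j * w ∧ v = sg i * w) ∨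
    (Adj i j ∧ ∃ w, u = sg j * (sg i * w) ∧ v = sg i * (sg j * w))

theorem L.symm {k : ℕ} {i j : Fin k} {u v : BM k} (h : L i j u v) : L j i v u := by
  rcases h with ⟨rfl, rfl⟩ | ⟨h, h', w, rfl, rfl⟩ | ⟨h, w, rfl, rfl⟩
  · exact Or.inl ⟨rfl, rfl⟩
  · exact Or.inr (Or.inl ⟨h.symm, fun h => h' h.symm, w, rfl, rfl⟩)
  · exact Or.inr (Or.inr ⟨h.symm, w, rfl, rfl⟩)

theorem L.mul {k : ℕ} {i j : Fin k} {u v : BM k} (h : L i j u v) (y : BM k) :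
    L i j (u * y) (v * y) := by
  rcases h with ⟨rfl, rfl⟩ | ⟨h, h', w, rfl, rfl⟩ | ⟨h, w, rfl, rfl⟩
  · exact Or.inl ⟨rfl, rfl⟩
  · exact Or.inr (Or.inl ⟨h, h', w * y, by simp only [mul_assoc], by simp only [mul_assoc]⟩)
  · exact Or.inr (Or.inr ⟨h, w * y, by simp only [mul_assoc], by simp only [mul_assoc]⟩)

theorem L.len_eq {k : ℕ} {i j : Fin k} {u v : BM k} (h : L i j u v) : len u = len v := by
  rcases h with ⟨rfl, rfl⟩ | ⟨h, h', w, rfl, rfl⟩ | ⟨h, w, rfl, rfl⟩ <;> simp [len_mul, len_sg]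

/-- Induction hypothesis. -/
def HH (k N : ℕ) : Prop :=
  ∀ (i j : Fin k) (u v : BM k), len u < N → sg i * u = sg j * v → L i j u v

theorem not_triangle {k : ℕ} {i j l : Fin k} (h : Adj i j) (h' : Adj j l) : ¬ Adj i l := by
  unfold Adj at *; omega

/-- Mixed case of transitivity. -/
theorem L.trans_mixed {k N : ℕ} (H : HH k N) {i l j : Fin k} {w w' : BM k}
    (h1 : i ≠ l) (h1' : ¬ Adj i l) (h2 : Adj l j) (e : sg i * w = sg j * (sg l * w'))
    (hN : len w + 1 ≤ N) : L i j (sg l * w) (sg l * (sg j * w')) := by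
  have hl := congrArg BraidAux.len e
  simp only [len_mul, len_sg] at hl
  have h1'' : ¬ Adj l i := fun h => h1' h.symm
  rcases H _ _ _ _ (by omega) e with ⟨rfl, _⟩ | ⟨h3, h3', x, rfl, e2⟩ | ⟨h3, x, rfl, e2⟩
  · exact absurd h2.symm h1'
  · simp only [len_mul, len_sg] at hl hN
    rcases H _ _ _ _ (by omega) e2 with ⟨rfl, _⟩ | ⟨h4, h4', y, rfl, rfl⟩ | ⟨h4, _⟩
    · exact absurd rfl h1
    · refine Or.inr (Or.inl ⟨h3, h3', sg l * (sg j * y), ?_, ?_⟩)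
      · exact sg_braid' h2 y
      · rw [sg_comm' h3.symm (fun h => h3' h.symm), sg_comm' h1.symm h1'']
    · exact absurd h4 h1''
  · simp only [len_mul, len_sg] at hl hN
    rcases H _ _ _ _ (by omega) e2 with ⟨rfl, _⟩ | ⟨h4, h4', y, rfl, e3⟩ | ⟨h4, _⟩
    · exact absurd rfl h1
    · simp only [len_mul, len_sg] at hl hN
      rcases H _ _ _ _ (by omega) e3 with ⟨rfl, _⟩ | ⟨_, h5, _⟩ | ⟨h5, z, rfl, rfl⟩
      · exact absurd rfl h2.ne
      · exact absurd h2.symm h5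
      · refine Or.inr (Or.inr ⟨h3, sg l * (sg j * (sg i * z)), ?_, ?_⟩)
        · rw [sg_comm' h1 h1', sg_braid' h2, ← sg_braid' h3, sg_comm' h1.symm h1'']
        · rw [← sg_braid' h3, sg_comm' h1.symm h1'', sg_comm' h1 h1' z, sg_braid' h2]
    · exact absurd h4 h1''

theorem L.trans {k N : ℕ} (H : HH k N) {i l j : Fin k} {u z v : BM k}
    (hN : BraidAux.len u ≤ N) (h1 : L i l u z) (h2 : L l j z v) : L i j u v := by
  have hz := h1.len_eq
  have hv := h2.len_eq
  rcases h1 with ⟨rfl, rfl⟩ | ⟨h1, h1', w, rfl, rfl⟩ | ⟨h1, w, rfl, rfl⟩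
  · exact h2
  · rcases h2 with ⟨rfl, rfl⟩ | ⟨h2, h2', w', e, rfl⟩ | ⟨h2, w', e, rfl⟩
    · exact Or.inr (Or.inl ⟨h1, h1', w, rfl, rfl⟩)
    · simp only [len_mul, len_sg] at hN
      rcases H _ _ _ _ (by omega) e with ⟨rfl, rfl⟩ | ⟨h3, h3', x, rfl, rfl⟩ | ⟨h3, x, rfl, rfl⟩
      · exact Or.inl ⟨rfl, rfl⟩
      · refine Or.inr (Or.inl ⟨h3, h3', sg l * x, ?_, ?_⟩)
        · rw [sg_comm' h2 h2']
        · rw [sg_comm' h1 h1']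
      · refine Or.inr (Or.inr ⟨h3, sg l * x, ?_, ?_⟩)
        · rw [sg_comm' h2 h2', sg_comm' h1 h1']
        · rw [← sg_comm' h1 h1', sg_comm' h2 h2']
    · simp only [len_mul, len_sg] at hN
      exact L.trans_mixed H h1 h1' h2 e (by omega)
  · rcases h2 with ⟨rfl, rfl⟩ | ⟨h2, h2', w', e, rfl⟩ | ⟨h2, w', e, rfl⟩
    · exact Or.inr (Or.inr ⟨h1, w, rfl, rfl⟩)
    · simp only [len_mul, len_sg] at hN hv
      exact (L.trans_mixed H h2.symm (fun h => h2' h.symm) h1.symm e.symm (by omega)).symm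
    · simp only [len_mul, len_sg] at hN hv
      rcases H _ _ _ _ (by simp only [len_mul, len_sg]; omega) e with
        ⟨rfl, e2⟩ | ⟨h3, h3', x, e2, e3⟩ | ⟨h3, _⟩
      · rcases H _ _ _ _ (by omega) e2 with ⟨_, rfl⟩ | ⟨h, _⟩ | ⟨h, _⟩
        · exact Or.inl ⟨rfl, rfl⟩
        · exact absurd rfl h
        · exact absurd rfl h.ne
      · have h3'' : ¬ Adj j i := fun h => h3' h.symm
        rcases H _ _ _ _ (by omega) e2 with ⟨rfl, _⟩ | ⟨_, h, _⟩ | ⟨_, y, rfl, rfl⟩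
        · exact absurd rfl h2.ne
        · exact absurd h2 h
        · simp only [len_mul, len_sg] at hN hv
          rcases H _ _ _ _ (by omega) e3 with ⟨rfl, _⟩ | ⟨_, h, _⟩ | ⟨_, y', rfl, e4⟩
          · exact absurd rfl h1.ne
          · exact absurd h1.symm h
          · rcases H _ _ _ _ (by simp only [len_mul, len_sg]; omega) e4 with
              ⟨_, e5⟩ | ⟨h, _⟩ | ⟨h, _⟩
            · rcases H _ _ _ _ (by omega) e5 with ⟨rfl, _⟩ | ⟨_, _, t, rfl, rfl⟩ | ⟨h, _⟩
              · exact absurd rfl h3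
              · refine Or.inr (Or.inl ⟨h3, h3', sg l * (sg j * (sg i * (sg l * t))), ?_, ?_⟩)
                · rw [sg_comm' h3 h3', sg_braid' h1, sg_braid' h2]
                · rw [← sg_comm' h3 h3', ← sg_braid' h2, ← sg_braid' h1, sg_comm' h3 h3']
              · exact absurd h h3''
            · exact absurd rfl h
            · exact absurd rfl h.ne
      · exact absurd h3 (not_triangle h1 h2)

theorem len_mk {k : ℕ} (a : FreeMonoid (Fin k)) : len (PresentedMonoid.mk (ARel k) a) = a.length := by
  induction a using FreeMonoid.recOn with
  | one => rfl
  | of_mul x xs ih => 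
    rw [map_mul, len_mul, ih]
    change 1 + _ = _
    simp

theorem cons_inj {k : ℕ} {i j : Fin k} {u v : FreeMonoid (Fin k)}
    (h : FreeMonoid.of i * u = FreeMonoid.of j * v) : i = j ∧ u = v :=
  List.cons.inj (α := Fin k) h

theorem word_cases {k : ℕ} (a : FreeMonoid (Fin k)) :
    a = 1 ∨ ∃ i u, a = FreeMonoid.of i * u := by
  cases a using FreeMonoid.casesOn with
  | one => exact Or.inl rfl
  | of_mul x xs => exact Or.inr ⟨_, _, rfl⟩

theorem conGen_L {k N : ℕ} (H : HH k N) (a b : FreeMonoid (Fin k)) (h : ConGen.Rel (ARel k) a b) :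
    a.length ≤ N + 1 → ∀ i u j v, a = FreeMonoid.of i * u → b = FreeMonoid.of j * v →
      L i j (PresentedMonoid.mk (ARel k) u) (PresentedMonoid.mk (ARel k) v) := by
  have hlen : ∀ {a b}, ConGen.Rel (ARel k) a b → a.length = b.length := by
    intro a b h
    rw [← len_mk, ← len_mk, PresentedMonoid.mk_eq_mk_iff.2 h]
  induction h with
  | of x y h =>
    rintro - i u j v rfl rfl
    generalize ha : FreeMonoid.of i * u = a at h
    generalize hb : FreeMonoid.of j * v = b at h
    cases h with
    | comm i' j' h h' =>
      obtain ⟨rfl, rfl⟩ := cons_inj ha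
      obtain ⟨rfl, rfl⟩ := cons_inj hb
      exact Or.inr (Or.inl ⟨h, h', 1, rfl, rfl⟩)
    | braid i' j' h =>
      obtain ⟨rfl, rfl⟩ := cons_inj ha
      obtain ⟨rfl, rfl⟩ := cons_inj hb
      exact Or.inr (Or.inr ⟨h, 1, rfl, rfl⟩)
  | refl x =>
    rintro - i u j v rfl h
    obtain ⟨rfl, rfl⟩ := cons_inj h
    exact Or.inl ⟨rfl, rfl⟩
  | symm h ih =>
    intro hN i u j v ha hb
    exact (ih (by rw [hlen h]; exact hN) j v i u hb ha).symm
  | @trans x y z h h' ih ih' =>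
    intro hN i u j v ha hb
    have e1 := hlen h
    rcases word_cases y with rfl | ⟨l, w, rfl⟩
    · subst ha; simp at e1
    · refine L.trans H ?_ (ih hN _ _ _ _ ha rfl) (ih' (e1 ▸ hN) _ _ _ _ rfl hb)
      rw [len_mk]; subst ha; simp at hN; omega
  | @mul w x y z h h' ih ih' =>
    intro hN i u j v ha hb
    have e1 := hlen h
    rcases word_cases w with rfl | ⟨i', w, rfl⟩
    · rcases word_cases x with rfl | ⟨j', x, rfl⟩
      · simp only [one_mul] at ha hb hN
        exact ih' hN _ _ _ _ ha hb
      · simp at e1; omega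
    · rcases word_cases x with rfl | ⟨j', x, rfl⟩
      · simp at e1
      · rw [mul_assoc] at ha hb
        obtain ⟨rfl, rfl⟩ := cons_inj ha
        obtain ⟨rfl, rfl⟩ := cons_inj hb
        rw [map_mul, map_mul, PresentedMonoid.mk_eq_mk_iff.2 h']
        refine (ih ?_ _ _ _ _ rfl rfl).mul _
        simp at hN ⊢; omega

theorem HH_all (k N : ℕ) : HH k N := by
  induction N with
  | zero => intro i j u v h; omega
  | succ N ih =>
    intro i j u v h e
    obtain ⟨u, rfl⟩ := PresentedMonoid.surjective_mk u
    obtain ⟨v, rfl⟩ := PresentedMonoid.surjective_mk v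
    have e' : PresentedMonoid.mk (ARel k) (FreeMonoid.of i * u) =
      PresentedMonoid.mk (ARel k) (FreeMonoid.of j * v) := e
    refine conGen_L ih _ _ (PresentedMonoid.mk_eq_mk_iff.1 e') ?_ _ _ _ _ rfl rfl
    rw [len_mk] at h; simp; omega

theorem garside {k : ℕ} {i j : Fin k} {u v : BM k} (h : sg i * u = sg j * v) : L i j u v :=
  HH_all k (len u + 1) i j u v (by omega) h

theorem sg_ind {k : ℕ} {p : BM k → Prop} (x : BM k) (one : p 1)
    (mul : ∀ i x, p x → p (sg i * x)) : p x := by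
  obtain ⟨a, rfl⟩ := PresentedMonoid.surjective_mk x
  induction a using FreeMonoid.recOn with
  | one => exact one
  | of_mul i xs ih => exact mul i _ ih

theorem left_cancel {k : ℕ} (x : BM k) {u v : BM k} (h : x * u = x * v) : u = v := by
  induction x using sg_ind with
  | one => simpa using h
  | mul i x ih =>
    rw [mul_assoc, mul_assoc] at h
    rcases garside h with ⟨_, h⟩ | ⟨h, _⟩ | ⟨h, _⟩
    · exact ih h
    · exact absurd rfl h
    · exact absurd rfl h.ne

section Delta

variable {N : Type*} [Monoid N] (s : ℕ → N)

/-- `s_0 ⋯ s_{m-1}`. -/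
def cc (m : ℕ) : N := ((List.range m).map s).prod

/-- Garside element. -/
def DD : ℕ → N
  | 0 => 1
  | m + 1 => cc s m * DD m

/-- Braid relations below `K`. -/
structure BR (K : ℕ) : Prop where
  hc : ∀ i j, i + 2 ≤ j → j < K → s i * s j = s j * s i
  hb : ∀ i, i + 1 < K → s i * (s (i + 1) * s i) = s (i + 1) * (s i * s (i + 1))

theorem cc_zero : cc s 0 = 1 := rfl

theorem cc_succ (m : ℕ) : cc s (m + 1) = cc s m * s m := by
  simp [cc, List.range_succ]

theorem DD_succ (m : ℕ) : DD s (m + 1) = cc s m * DD s m := rfl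

variable {s} {K : ℕ}

theorem cc_comm (h : BR s K) (m j : ℕ) (hj : m + 1 ≤ j) (hK : j < K) :
    cc s m * s j = s j * cc s m := by
  induction m with
  | zero => simp [cc_zero]
  | succ m ih =>
    rw [cc_succ, mul_assoc, h.hc m j (by omega) hK, ← mul_assoc, ih (by omega), mul_assoc]

theorem cc_shift (h : BR s K) (m i : ℕ) (hi : i + 1 < m) (hK : m ≤ K) :
    cc s m * s i = s (i + 1) * cc s m := by
  induction m with
  | zero => omega
  | succ m ih =>
    by_cases him : i + 1 < m
    · rw [cc_succ, mul_assoc, ← h.hc i m (by omega) (by omega), ← mul_assoc,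
        ih him (by omega), mul_assoc]
    · obtain rfl : m = i + 1 := by omega
      rw [cc_succ, cc_succ, mul_assoc, mul_assoc, h.hb i (by omega), ← mul_assoc,
        cc_comm h i (i + 1) le_rfl (by omega)]
      simp only [mul_assoc]

theorem cc_cc (h : BR s K) (m k : ℕ) (hk : k + 1 ≤ m) (hK : m ≤ K) :
    s 0 * (cc s m * cc s k) = cc s (k + 1) * cc s m := by
  induction k with
  | zero => simp [cc_zero, cc_succ]
  | succ k ih =>
    rw [cc_succ s k, ← mul_assoc (cc s m), ← mul_assoc, ih (by omega), mul_assoc,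
      cc_shift h m k (by omega) hK, ← mul_assoc, ← cc_succ]

theorem DD_comm (h : BR s K) (m j : ℕ) (hj : m ≤ j) (hK : j < K) :
    DD s m * s j = s j * DD s m := by
  induction m with
  | zero => simp [DD]
  | succ m ih =>
    rw [DD_succ, mul_assoc, ih (by omega), ← mul_assoc, cc_comm h m j hj hK, mul_assoc]

theorem DD_conj (h : BR s K) (m : ℕ) (hK : m ≤ K) (i : ℕ) (hi : i < m) :
    s i * DD s (m + 1) = DD s (m + 1) * s (m - 1 - i) := by
  induction m generalizing i with
  | zero => omega
  | succ m ih =>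
    rcases i with _ | i
    · rw [DD_succ, DD_succ, ← mul_assoc (cc s (m + 1)), ← mul_assoc, cc_cc h _ _ le_rfl hK]
      rw [cc_succ s m]
      simp only [mul_assoc, add_tsub_cancel_right, Nat.sub_zero]
      rw [DD_comm h m m le_rfl (by omega)]
    · rw [DD_succ, ← mul_assoc, ← cc_shift h (m + 1) i hi hK, mul_assoc, ih (by omega) i (by omega),
        mul_assoc]
      congr 3; omega

theorem cc_div (m : ℕ) : ∃ y, cc s (m + 1) = s 0 * y := by
  induction m with
  | zero => exact ⟨1, by simp [cc_succ, cc_zero]⟩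
  | succ m ih =>
    obtain ⟨y, hy⟩ := ih
    exact ⟨y * s (m + 1), by rw [cc_succ, hy, mul_assoc]⟩

theorem DD_div (h : BR s K) (m : ℕ) (hK : m ≤ K) (i : ℕ) (hi : i < m) :
    ∃ x, DD s (m + 1) = s i * x := by
  induction m generalizing i with
  | zero => omega
  | succ m ih =>
    rcases i with _ | i
    · obtain ⟨y, hy⟩ := cc_div (s := s) m
      exact ⟨y * DD s (m + 1), by rw [DD_succ, hy, mul_assoc]⟩
    · obtain ⟨x, hx⟩ := ih (by omega) i (by omega)
      exact ⟨cc s (m + 1) * x, by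
        rw [DD_succ, hx, ← mul_assoc, cc_shift h (m + 1) i hi hK, mul_assoc]⟩

theorem DD_sq_comm (h : BR s K) (i : ℕ) (hi : i < K) :
    s i * (DD s (K + 1) * DD s (K + 1)) = DD s (K + 1) * DD s (K + 1) * s i := by
  rw [← mul_assoc, DD_conj h K le_rfl i hi, mul_assoc, DD_conj h K le_rfl _ (by omega), mul_assoc]
  congr 3; omega

end Delta

/-- Extension of a family by `1`. -/
def ext1 {N : Type*} [Monoid N] {k : ℕ} (f : Fin k → N) (i : ℕ) : N :=
  if h : i < k then f ⟨i, h⟩ else 1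

theorem ext1_val {N : Type*} [Monoid N] {k : ℕ} (f : Fin k → N) (i : Fin k) :
    ext1 f i = f i := by simp [ext1]

theorem BR_sg (k : ℕ) : BR (ext1 (sg (k := k))) k where
  hc i j h hj := by
    have hi : i < k := by omega
    simp only [ext1, hi, hj, dite_true]
    refine sg_comm ?_ ?_
    · intro h; simp at h; omega
    · unfold Adj; simp; omega
  hb i hi := by
    have hi' : i < k := by omega
    simp only [ext1, hi, hi', dite_true]
    exact sg_braid (Or.inl rfl)

/-- The central element. -/
def ZZ (k : ℕ) : BM k := DD (ext1 sg) (k + 1) * DD (ext1 sg) (k + 1)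

theorem ZZ_comm {k : ℕ} (x : BM k) : x * ZZ k = ZZ k * x := by
  induction x using sg_ind with
  | one => simp
  | mul i x ih =>
    have := DD_sq_comm (BR_sg k) i i.2
    rw [ext1_val] at this
    rw [mul_assoc, ih, ← mul_assoc, ← mul_assoc]
    exact congrArg (· * x) this

theorem ZZ_div {k : ℕ} (i : Fin k) : ∃ x, sg i * x = ZZ k ∧ x * sg i = ZZ k := by
  obtain ⟨x, hx⟩ := DD_div (BR_sg k) k le_rfl i i.2
  rw [ext1_val] at hx
  have h1 : sg i * (x * DD (ext1 sg) (k + 1)) = ZZ k := by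
    rw [← mul_assoc, ← hx]; rfl
  refine ⟨_, h1, ?_⟩
  apply left_cancel (sg i)
  rw [← mul_assoc, h1, ZZ_comm]

theorem pow_comm {k : ℕ} (s : Submonoid.powers (ZZ k)) (x : BM k) : (s : BM k) * x = x * s := by
  obtain ⟨_, m, rfl⟩ := s
  exact ((show Commute x (ZZ k) from ZZ_comm x).pow_right m).symm

/-- The Ore set of powers of the central element. -/
instance oreZ (k : ℕ) : OreLocalization.OreSet (Submonoid.powers (ZZ k)) where
  ore_right_cancel r₁ r₂ s h := ⟨s, by rw [pow_comm, pow_comm, h]⟩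
  oreNum r _ := r
  oreDenom _ s := s
  ore_eq r s := pow_comm s r

/-- The localized monoid. -/
abbrev LM (k : ℕ) := OreLocalization (Submonoid.powers (ZZ k)) (BM k)

/-- The localization map. -/
def toLM (k : ℕ) : BM k →* LM k := OreLocalization.numeratorHom

theorem toLM_inj {k : ℕ} {x y : BM k} (h : toLM k x = toLM k y) : x = y := by
  have h' : (OreLocalization.oreDiv x (1 : Submonoid.powers (ZZ k)) : LM k) =
    OreLocalization.oreDiv y 1 := h
  rw [OreLocalization.oreDiv_eq_iff] at h'
  obtain ⟨u, v, h1, h2⟩ := h'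
  simp only [OneMemClass.coe_one, mul_one] at h2
  rw [← h2] at h1
  exact (left_cancel _ h1).symm

theorem toLM_sg_unit {k : ℕ} (i : Fin k) : IsUnit (toLM k (sg i)) := by
  obtain ⟨x, h1, h2⟩ := ZZ_div i
  obtain ⟨u, hu⟩ : IsUnit (toLM k (ZZ k)) :=
    OreLocalization.numerator_isUnit (⟨ZZ k, Submonoid.mem_powers _⟩ : Submonoid.powers (ZZ k))
  have e1 := congrArg (toLM k) h1
  have e2 := congrArg (toLM k) h2
  rw [map_mul, ← hu] at e1 e2
  rw [isUnit_iff_exists_and_exists]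
  refine ⟨⟨toLM k x * ↑u⁻¹, ?_⟩, ⟨↑u⁻¹ * toLM k x, ?_⟩⟩
  · rw [← mul_assoc, e1, Units.mul_inv]
  · rw [mul_assoc, e2, Units.inv_mul]

/-- Generators as units. -/
noncomputable def sgU {k : ℕ} (i : Fin k) : (LM k)ˣ := (toLM_sg_unit i).unit

theorem sgU_val {k : ℕ} (i : Fin k) : (sgU i : LM k) = toLM k (sg i) := rfl

/-- The map from the braid group to the units of the localization. -/
noncomputable def ψ (n : ℕ) : BraidGroup n →* (LM (n - 1))ˣ :=
  PresentedGroup.toGroup (rels := braidRels n) (f := sgU) (by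
    rintro r (⟨i, j, h, rfl⟩ | ⟨i, j, h, rfl⟩)
    · rw [map_mul, map_inv, mul_inv_eq_one]
      simp only [map_mul, FreeGroup.lift_apply_of]
      ext
      simp only [Units.val_mul, sgU_val, ← map_mul]
      rw [sg_comm]
      · rintro rfl; omega
      · unfold Adj; omega
    · rw [map_mul, map_inv, mul_inv_eq_one]
      simp only [map_mul, FreeGroup.lift_apply_of]
      ext
      simp only [Units.val_mul, sgU_val, ← map_mul, mul_assoc]
      rw [sg_braid (Or.inl h)])

theorem ψ_gen {n : ℕ} (i : Fin (n - 1)) : ψ n (braidGen i) = sgU i :=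
  PresentedGroup.toGroup.of _

theorem bg_comm {n : ℕ} {i j : Fin (n - 1)} (h : i ≠ j) (h' : ¬ Adj i j) :
    braidGen i * braidGen j = braidGen j * braidGen i := by
  have key : ∀ i j : Fin (n - 1), (i : ℕ) + 2 ≤ j →
      braidGen i * braidGen j = braidGen j * braidGen i := by
    intro i j h
    exact PresentedGroup.mk_eq_mk_of_mul_inv_mem (rels := braidRels n) (Or.inl ⟨i, j, h, rfl⟩)
  have : (i : ℕ) ≠ j := fun e => h (Fin.ext e)
  unfold Adj at h'
  by_cases hij : (i : ℕ) + 2 ≤ j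
  · exact key i j hij
  · exact (key j i (by omega)).symm

theorem bg_braid {n : ℕ} {i j : Fin (n - 1)} (h : Adj i j) :
    braidGen i * (braidGen j * braidGen i) = braidGen j * (braidGen i * braidGen j) := by
  have key : ∀ i j : Fin (n - 1), (i : ℕ) + 1 = j →
      braidGen i * (braidGen j * braidGen i) = braidGen j * (braidGen i * braidGen j) := by
    intro i j h
    rw [← mul_assoc, ← mul_assoc]
    exact PresentedGroup.mk_eq_mk_of_mul_inv_mem (rels := braidRels n) (Or.inr ⟨i, j, h, rfl⟩)
  rcases h with h | h
  · exact key i j h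
  · exact (key j i h).symm

/-- The map from the braid monoid to the braid group. -/
def φ (n : ℕ) : BM (n - 1) →* BraidGroup n :=
  PresentedMonoid.lift braidGen (by
    intro a b h
    cases h with
    | comm i j h h' => simpa using bg_comm h h'
    | braid i j h => simpa using bg_braid h)

theorem φ_sg {n : ℕ} (i : Fin (n - 1)) : φ n (sg i) = braidGen i := rfl

theorem φ_inj {n : ℕ} {x y : BM (n - 1)} (h : φ n x = φ n y) : x = y := by
  have key : ∀ x : BM (n - 1), ((ψ n (φ n x) : (LM (n - 1))ˣ) : LM (n - 1)) = toLM _ x := by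
    intro x
    induction x using sg_ind with
    | one => simp
    | mul i x ih => rw [map_mul, map_mul, Units.val_mul, ih, φ_sg, ψ_gen, sgU_val, map_mul]
  apply toLM_inj
  rw [← key, ← key, h]

theorem gen_mem {n : ℕ} (i : Fin (n - 1)) : braidGen i ∈ PosBraid n :=
  Submonoid.subset_closure ⟨i, rfl⟩

theorem φ_mem {n : ℕ} (x : BM (n - 1)) : φ n x ∈ PosBraid n := by
  induction x using sg_ind with
  | one => simpa using one_mem _
  | mul i x ih => rw [map_mul]; exact mul_mem (gen_mem i) ih

theorem mem_φ {n : ℕ} {p : BraidGroup n} (h : p ∈ PosBraid n) : ∃ x, φ n x = p := by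
  have : PosBraid n ≤ MonoidHom.mrange (φ n) := by
    apply (Submonoid.closure_le).2
    rintro _ ⟨i, rfl⟩
    exact ⟨sg i, rfl⟩
  exact this h

theorem divL_trans {n : ℕ} {x y z : BraidGroup n} (h : DividesL x y) (h' : DividesL y z) :
    DividesL x z := by
  obtain ⟨p, hp, rfl⟩ := h
  obtain ⟨q, hq, rfl⟩ := h'
  exact ⟨p * q, mul_mem hp hq, mul_assoc _ _ _⟩

theorem divL_refl {n : ℕ} (x : BraidGroup n) : DividesL x x := ⟨1, one_mem _, by simp⟩

theorem divL_mul {n : ℕ} (a : BraidGroup n) {x y : BraidGroup n} :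
    DividesL (a * x) (a * y) ↔ DividesL x y := by
  simp [DividesL, mul_assoc]

/-- Generators have least common multiples. -/
theorem gen_lcm {n : ℕ} (i j : Fin (n - 1)) : ∃ l : BraidGroup n,
    DividesL (braidGen i) l ∧ DividesL (braidGen j) l ∧
      ∀ x, DividesL (braidGen i) x → DividesL (braidGen j) x → DividesL l x := by
  have key : ∀ x, DividesL (braidGen i) x → DividesL (braidGen j) x →
      ∃ u v, x = braidGen i * φ n u ∧ L i j u v := by
    rintro x ⟨p, hp, rfl⟩ ⟨q, hq, e⟩
    obtain ⟨u, rfl⟩ := mem_φ hp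
    obtain ⟨v, rfl⟩ := mem_φ hq
    refine ⟨u, v, rfl, garside (φ_inj ?_)⟩
    simpa [φ_sg] using e
  by_cases hij : i = j
  · subst hij
    exact ⟨_, divL_refl _, divL_refl _, fun x h _ => h⟩
  by_cases ha : Adj i j
  · refine ⟨braidGen i * (braidGen j * braidGen i),
      ⟨_, mul_mem (gen_mem _) (gen_mem _), rfl⟩,
      ⟨_, mul_mem (gen_mem _) (gen_mem _), bg_braid ha⟩, ?_⟩
    intro x h1 h2
    obtain ⟨u, v, rfl, ⟨h, _⟩ | ⟨_, h, _⟩ | ⟨_, w, rfl, _⟩⟩ := key x h1 h2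
    · exact absurd h hij
    · exact absurd ha h
    · exact ⟨φ n w, φ_mem w, by simp [φ_sg, mul_assoc]⟩
  · refine ⟨braidGen i * braidGen j,
      ⟨_, gen_mem _, rfl⟩, ⟨_, gen_mem _, bg_comm hij ha⟩, ?_⟩
    intro x h1 h2
    obtain ⟨u, v, rfl, ⟨h, _⟩ | ⟨_, h, w, rfl, _⟩ | ⟨h, _⟩⟩ := key x h1 h2
    · exact absurd h hij
    · exact ⟨φ n w, φ_mem w, by simp [φ_sg, mul_assoc]⟩
    · exact absurd h ha

/-- Exponent sum. -/
def expo (n : ℕ) : BraidGroup n →* Multiplicative ℤ :=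
  PresentedGroup.toGroup (rels := braidRels n) (f := fun _ => Multiplicative.ofAdd 1) (by
    rintro r (⟨i, j, h, rfl⟩ | ⟨i, j, h, rfl⟩) <;> simp)

/-- Exponent sum as an integer. -/
def ex {n : ℕ} (x : BraidGroup n) : ℤ := Multiplicative.toAdd (expo n x)

theorem ex_mul {n : ℕ} (x y : BraidGroup n) : ex (x * y) = ex x + ex y := by simp [ex]

theorem ex_gen {n : ℕ} (i : Fin (n - 1)) : ex (braidGen i) = 1 := by
  have : expo n (braidGen i) = Multiplicative.ofAdd 1 := PresentedGroup.toGroup.of _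
  rw [ex, this]; rfl

theorem ex_nonneg {n : ℕ} {p : BraidGroup n} (h : p ∈ PosBraid n) : 0 ≤ ex p := by
  induction h using Submonoid.closure_induction with
  | mem x h => obtain ⟨i, rfl⟩ := h; rw [ex_gen]; norm_num
  | one => simp [ex]
  | mul x y _ _ hx hy => rw [ex_mul]; omega

theorem pos_cases {n : ℕ} {p : BraidGroup n} (h : p ∈ PosBraid n) :
    p = 1 ∨ ∃ i, DividesL (braidGen i) p := by
  obtain ⟨x, rfl⟩ := mem_φ h
  cases x using sg_ind with
  | one => exact Or.inl (map_one _)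
  | mul i x _ => exact Or.inr ⟨i, φ n x, φ_mem x, by rw [map_mul, φ_sg]⟩

theorem greatest {n : ℕ} (X Y : BraidGroup n) (N : ℕ) : ∀ a : BraidGroup n,
    DividesL a X → DividesL a Y → ex X - ex a ≤ N →
    ∃ g, DividesL a g ∧ DividesL g X ∧ DividesL g Y ∧
      ∀ d, DividesL a d → DividesL d X → DividesL d Y → DividesL d g := by
  induction N with
  | zero =>
    intro a haX haY hN
    refine ⟨a, divL_refl a, haX, haY, ?_⟩
    rintro d ⟨p, hp, rfl⟩ ⟨q, hq, rfl⟩ -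
    rcases pos_cases hp with rfl | ⟨i, z, hz, rfl⟩
    · simpa using divL_refl a
    · have := ex_nonneg hz
      have := ex_nonneg hq
      simp only [ex_mul, ex_gen] at hN
      push_cast at hN
      omega
  | succ N ih =>
    intro a haX haY hN
    have ih' : ∀ i, DividesL (a * braidGen i) X → DividesL (a * braidGen i) Y →
        ∃ g, DividesL (a * braidGen i) g ∧ DividesL g X ∧ DividesL g Y ∧
        ∀ d, DividesL (a * braidGen i) d → DividesL d X → DividesL d Y → DividesL d g := by
      intro i h1 h2
      refine ih _ h1 h2 ?_
      rw [ex_mul, ex_gen]; push_cast at hN; omega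
    by_cases hex : ∃ i, DividesL (a * braidGen i) X ∧ DividesL (a * braidGen i) Y
    · obtain ⟨i, hiX, hiY⟩ := hex
      obtain ⟨g, hg, hgX, hgY, hmax⟩ := ih' i hiX hiY
      refine ⟨g, divL_trans ⟨_, gen_mem i, rfl⟩ hg, hgX, hgY, ?_⟩
      rintro d ⟨p, hp, rfl⟩ hdX hdY
      rcases pos_cases hp with rfl | ⟨j, hj⟩
      · rw [mul_one]; exact divL_trans ⟨_, gen_mem i, rfl⟩ hg
      · have hj' := (divL_mul a).2 hj
        obtain ⟨g', hg', hgX', hgY', hmax'⟩ := ih' j (divL_trans hj' hdX) (divL_trans hj' hdY)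
        obtain ⟨l, hil, hjl, hl⟩ := gen_lcm i j
        have conv : ∀ T, DividesL (a * braidGen i) T → DividesL (a * braidGen j) T →
            DividesL (a * l) T := by
          intro T h1 h2
          obtain ⟨T, rfl⟩ : ∃ T', T = a * T' := ⟨a⁻¹ * T, by simp⟩
          exact (divL_mul a).2 (hl _ ((divL_mul a).1 h1) ((divL_mul a).1 h2))
        have hlX := conv X hiX (divL_trans hj' hdX)
        have hlY := conv Y hiY (divL_trans hj' hdY)
        have hlg' : DividesL (a * l) g' := hmax' _ ((divL_mul a).2 hjl) hlX hlY
        exact divL_trans (hmax' _ hj' hdX hdY)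
          (hmax _ (divL_trans ((divL_mul a).2 hil) hlg') hgX' hgY')
    · refine ⟨a, divL_refl a, haX, haY, ?_⟩
      rintro d ⟨p, hp, rfl⟩ hdX hdY
      rcases pos_cases hp with rfl | ⟨i, hi⟩
      · simpa using divL_refl a
      · exact absurd ⟨i, divL_trans ((divL_mul a).2 hi) hdX,
          divL_trans ((divL_mul a).2 hi) hdY⟩ hex

theorem deltaAux_eq (n m : ℕ) : deltaAux n m = DD (ext1 (braidGen (n := n))) m := by
  induction m with
  | zero => rfl
  | succ m ih => rw [DD_succ, ← ih]; rfl

theorem BR_gen (n : ℕ) : BR (ext1 (braidGen (n := n))) (n - 1) where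
  hc i j h hj := by
    have hi : i < n - 1 := by omega
    simp only [ext1, hi, hj, dite_true]
    refine bg_comm ?_ ?_
    · intro h; simp at h; omega
    · unfold Adj; simp; omega
  hb i hi := by
    have hi' : i < n - 1 := by omega
    simp only [ext1, hi, hi', dite_true]
    exact bg_braid (Or.inl rfl)

theorem delta_conj {n : ℕ} {p : BraidGroup n} (h : p ∈ PosBraid n) :
    (braidDelta n)⁻¹ * p * braidDelta n ∈ PosBraid n := by
  induction h using Submonoid.closure_induction with
  | mem x h =>
    obtain ⟨i, rfl⟩ := h
    have hi := i.2
    have e := DD_conj (BR_gen n) (n - 1) le_rfl i i.2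
    rw [show n - 1 + 1 = n by omega, ← deltaAux_eq, ext1_val] at e
    change _ * braidDelta n = braidDelta n * _ at e
    rw [mul_assoc, e, inv_mul_cancel_left]
    have := gen_mem (n := n) ⟨n - 1 - 1 - i, by omega⟩
    rw [← ext1_val braidGen] at this
    exact this
  | one => simpa using one_mem _
  | mul x y _ _ hx hy => simpa [mul_assoc] using mul_mem hx hy

end BraidAux

open BraidAux in
/-- Grid lemma for `P`-tiles: with `t_0 s_1 = s'_1 t_1` and `t_1 s_2 = s'_2 t_2`,
if `(s_1, s_2)` and `(s'_1, t_1)` are normal pairs then `(s'_1, s'_2)` is a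
normal pair. -/
theorem grid_P_tile (n : ℕ) (s1 s2 s1' s2' t0 t1 t2 : BraidGroup n)
    (hs1 : Simple s1) (hs2 : Simple s2) (hs1' : Simple s1') (hs2' : Simple s2')
    (ht0 : Simple t0) (ht1 : Simple t1) (ht2 : Simple t2)
    (e1 : t0 * s1 = s1' * t1) (e2 : t1 * s2 = s2' * t2)
    (hn1 : GNormal s1 s2) (hn2 : GNormal s1' t1) :
    GNormal s1' s2' := by
  refine ⟨hs1'.1, ⟨s2', hs2'.1, rfl⟩, hs1'.2, ?_⟩
  intro d hd hd1 hd2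
  have eX : t0 * (s1 * s2) = s1' * s2' * t2 := by
    rw [← mul_assoc, e1, mul_assoc, e2, mul_assoc]
  have hX : t0 * (s1 * s2) ∈ PosBraid n := mul_mem ht0.1 (mul_mem hs1.1 hs2.1)
  have hdX : DividesL d (t0 * (s1 * s2)) := by
    rw [eX]; exact divL_trans hd1 ⟨t2, ht2.1, rfl⟩
  have htX : DividesL t0 (t0 * (s1 * s2)) := ⟨_, mul_mem hs1.1 hs2.1, rfl⟩
  have one_div : ∀ {p : BraidGroup n}, p ∈ PosBraid n → DividesL 1 p :=
    fun {p} hp => ⟨p, hp, by simp⟩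
  obtain ⟨w, hw, ew⟩ := ht0.2
  have hΔ : braidDelta n ∈ PosBraid n := by rw [ew]; exact mul_mem ht0.1 hw
  obtain ⟨g, -, hgX, hgΔ, hmax⟩ := greatest (t0 * (s1 * s2)) (braidDelta n)
    (ex (t0 * (s1 * s2))).toNat 1 (one_div hX) (one_div hΔ) (by
      have := ex_nonneg hX
      have h1 : ex (1 : BraidGroup n) = 0 := by simp [ex]
      rw [h1]; omega)
  obtain ⟨e, he, rfl⟩ := hmax t0 (one_div ht0.1) htX ht0.2
  have hdg := hmax d (one_div hd) hdX hd2
  have heΔ : DividesL e (braidDelta n) := by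
    obtain ⟨f, hf, ef⟩ := hgΔ
    refine ⟨f * ((braidDelta n)⁻¹ * t0 * braidDelta n), mul_mem hf (delta_conj ht0.1), ?_⟩
    have : e * f = t0⁻¹ * braidDelta n := by rw [ef]; group
    rw [← mul_assoc, this]; group
  have hes : DividesL e s1 := hn1.2.2.2 e he ((divL_mul t0).1 hgX) heΔ
  have hds : DividesL d (s1' * t1) := by
    rw [← e1]; exact divL_trans hdg ((divL_mul t0).2 hes)
  exact hn2.2.2.2 d hd hds hd2
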